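/- Let G = (V, E) be a finite DAG, U ⊆ V, and v ∈ V with v ∉ L∞(U) and De(v) ∩ L∞(U) ≠ ∅. Then there is exactly one node v' ∈ L∞(U) such that there exists a path from v to v' uninterrupted by L∞(U). -/

import Mathlib

open scoped Classical

/-! ## Directed graphs, paths, ancestors -/

/-- A directed graph (given by its edge relation) is acyclic if no node is
reachable from itself by a non-trivial directed walk. -/
def Acyclic {V : Type} (E : V → V → Prop) : Prop :=
  ∀ v : V, ¬ Relation.TransGen E v v

/-- `IsPath E a b p` : the list `p` is a directed path from `a` to `b` in the
graph with edge relation `E` (a path is a nonempty list of nodes in which each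
node has an edge to the next; a single-node path is trivial). -/
def IsPath {V : Type} (E : V → V → Prop) (a b : V) (p : List V) : Prop :=
  p.Chain' E ∧ p.head? = some a ∧ p.getLast? = some b

/-- Descendants of `v` (every node is a descendant of itself). -/
def De {V : Type} (E : V → V → Prop) (v : V) : Set V :=
  {u | Relation.ReflTransGen E v u}

/-- Ancestors of `v` (every node is an ancestor of itself). -/
def An {V : Type} (E : V → V → Prop) (v : V) : Set V :=
  {u | Relation.ReflTransGen E u v}

/-- Parents of `v`. -/
def Pa {V : Type} (E : V → V → Prop) (v : V) : Set V :=
  {p | E p v}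

/-! ## Strict common ancestors, LSCAs, and the LSCA closure -/

/-- `v` is a strict common ancestor of `x` and `y` : there is a path from `v`
to `x` not containing `y`, and a path from `v` to `y` not containing `x`. -/
def SCA {V : Type} (E : V → V → Prop) (x y : V) : Set V :=
  {v | (∃ p, IsPath E v x p ∧ y ∉ p) ∧ (∃ p, IsPath E v y p ∧ x ∉ p)}

/-- `v` is a lowest strict common ancestor of `x` and `y` : it is a strict
common ancestor, and no strict common ancestor of `x,y` other than `v` is a
descendant of `v`. -/
def LSCApair {V : Type} (E : V → V → Prop) (x y : V) : Set V :=
  {v | v ∈ SCA E x y ∧ ∀ w ∈ SCA E x y, w ≠ v → w ∉ De E v}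

/-- The lowest strict common ancestors of a set `U` : nodes outside `U` that
are a lowest strict common ancestor of some pair of nodes of `U`. -/
def LSCAset {V : Type} (E : V → V → Prop) (U : Set V) : Set V :=
  {v | v ∉ U ∧ ∃ u ∈ U, ∃ u' ∈ U, v ∈ LSCApair E u u'}

/-- The `i`-th order LSCA set of `U`. -/
def lscaIter {V : Type} (E : V → V → Prop) (U : Set V) : ℕ → Set V
  | 0 => U
  | k + 1 => LSCAset E (lscaIter E U k) ∪ lscaIter E U k

/-- The LSCA closure `L∞(U)` of `U`.  (The sets `lscaIter E U i` are increasing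
in `i`, so on a finite node type this union equals `lscaIter E U k` for the
least `k` with `lscaIter E U k = lscaIter E U (k+1)`.) -/
def lscaClosure {V : Type} (E : V → V → Prop) (U : Set V) : Set V :=
  ⋃ k : ℕ, lscaIter E U k

/-! ## Λ-structures -/

/-- `(v, pa, pb)` is a Λ-structure over `(a, b)` : `pa` is a path from `v` to
`a`, `pb` is a path from `v` to `b`, and the two paths intersect only at `v`
(trivial paths are allowed). -/
def IsLambdaStruct {V : Type} (E : V → V → Prop) (v a b : V) (pa pb : List V) : Prop :=
  IsPath E v a pa ∧ IsPath E v b pb ∧ ∀ w ∈ pa, w ∈ pb → w = v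

/-- `Λ(U, W)` : the set of nodes forming a Λ-structure over `(U, W)`. -/
def LambdaSet {V : Type} (E : V → V → Prop) (U W : Set V) : Set V :=
  {v | ∃ u ∈ U, ∃ w ∈ W, ∃ pa pb : List V, IsLambdaStruct E v u w pa pb}

/-! ## Structural causal models -/

/-- A structural causal model over the graph with node type `V` and edge
relation `E` : each node `v` has a nonempty finite range `R v`, a nonempty
finite noise range `N v`, and a structural assignment `f v` computing the value
of `v` from the values of its parents and its noise value. -/
structure SCM (V : Type) (E : V → V → Prop) where
  R : V → Type
  rFin : ∀ v, Finite (R v)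
  rNe : ∀ v, Nonempty (R v)
  N : V → Type
  nFin : ∀ v, Finite (N v)
  nNe : ∀ v, Nonempty (N v)
  f : ∀ v : V, (∀ p : {p // E p v}, R p.1) → N v → R v

/-- Fuel-bounded approximation to the unrolled assignment. -/
noncomputable def approx {V : Type} {E : V → V → Prop} (scm : SCM V E)
    (n : ∀ v, scm.N v) : ℕ → ∀ v, scm.R v
  | 0 => fun v => (scm.rNe v).some
  | k + 1 => fun v => scm.f v (fun p => approx scm n k p.1) (n v)

/-- The unrolled assignment `f̄_v(n)` of an SCM over an acyclic graph: the value
of `v` obtained by recursively composing the structural assignments of the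
ancestors of `v`, evaluated at the unit `n`.  (On an acyclic graph every
directed path has fewer than `card V + 1` nodes, so this fuel value computes
the exact fixed point of the unrolling recursion
`f̄_v(n) = f_v((f̄_p(n))_{p ∈ Pa(v)}, n_v)`.) -/
noncomputable def unroll {V : Type} [Fintype V] {E : V → V → Prop} (scm : SCM V E)
    (n : ∀ v, scm.N v) (v : V) : scm.R v :=
  approx scm n (Fintype.card V + 1) v

/-- The atomic intervention `do(X = x)` : replace the structural assignment of
`X` by the constant function with value `x`. -/
noncomputable def SCM.intervene {V : Type} {E : V → V → Prop} (scm : SCM V E)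
    (X : V) (x : scm.R X) : SCM V E where
  R := scm.R
  rFin := scm.rFin
  rNe := scm.rNe
  N := scm.N
  nFin := scm.nFin
  nNe := scm.nNe
  f := fun v => if h : v = X then fun _ _ => h.symm ▸ x else scm.f v

/-- Fuel-bounded approximation to the blocked unrolled assignment. -/
noncomputable def blockApprox {V : Type} [Fintype V] {E : V → V → Prop} (scm : SCM V E)
    (B : V) (b : scm.R B) (n : ∀ v, scm.N v) : ℕ → ∀ v, scm.R v
  | 0 => fun v =>
      if h : v = B then h.symm ▸ b
      else if Relation.ReflTransGen E B v then (scm.rNe v).some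
      else unroll scm n v
  | k + 1 => fun v =>
      if h : v = B then h.symm ▸ b
      else if Relation.ReflTransGen E B v then
        scm.f v (fun p => blockApprox scm B b n k p.1) (n v)
      else unroll scm n v

/-- The blocked unrolled assignment `f̄_v[B](b, n)` : equal to `b` at `v = B`,
to the plain unrolled assignment `f̄_v(n)` if `v` is not a descendant of `B`,
and otherwise obtained by the unrolling recursion
`f̄_v[B](b,n) = f_v((f̄_p[B](b,n))_{p ∈ Pa(v)}, n_v)`. -/
noncomputable def blockUnroll {V : Type} [Fintype V] {E : V → V → Prop} (scm : SCM V E)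
    (B : V) (b : scm.R B) (n : ∀ v, scm.N v) (v : V) : scm.R v :=
  blockApprox scm B b n (Fintype.card V + 1) v

/-- The edge relation of the graph obtained after a conditional intervention on
`X` with conditioning set `A` : the parent set of `X` becomes `A`, and all
other edges are unchanged. -/
def condE {V : Type} (E : V → V → Prop) (X : V) (A : Set V) : V → V → Prop :=
  fun a b => (b = X ∧ a ∈ A) ∨ (b ≠ X ∧ E a b)

/-- The conditional intervention `do(X = g(A))` : replace the structural
assignment of `X` by the function that, given the values of the nodes in `A`,
outputs `g` of those values, so that `A` becomes the parent set of `X`. -/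
noncomputable def SCM.condIntervene {V : Type} {E : V → V → Prop} (scm : SCM V E)
    (X : V) (A : Set V) (g : (∀ a : A, scm.R a.1) → scm.R X) :
    SCM V (condE E X A) where
  R := scm.R
  rFin := scm.rFin
  rNe := scm.rNe
  N := scm.N
  nFin := scm.nFin
  nNe := scm.nNe
  f := fun v par nv =>
    if h : v = X then h.symm ▸ g (fun a => par ⟨a.1, Or.inl ⟨h, a.2⟩⟩)
    else scm.f v (fun p => par ⟨p.1, Or.inr ⟨h, p.2⟩⟩) nv

/-! ## Interventional superiority -/

/-- `X` is (deterministically atomic-interventionally) superior to `W` relative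
to `Y` : for every SCM over the graph in which the range of `Y` is linearly
ordered, and every unit `n`, there is `x ∈ R_X` such that for all `w ∈ R_W`,
`f̄_Y^{do(X=x)}(n) ≥ f̄_Y^{do(W=w)}(n)`. -/
def Superior {V : Type} [Fintype V] (E : V → V → Prop) (Y X W : V) : Prop :=
  ∀ (scm : SCM V E) (L : LinearOrder (scm.R Y)) (n : ∀ v, scm.N v),
    ∃ x : scm.R X, ∀ w : scm.R W,
      L.le (unroll (scm.intervene W w) n Y) (unroll (scm.intervene X x) n Y)

/-- Superiority for sets of nodes: `S ≽_Y T` iff every node of `T` is inferior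
to some node of `S`. -/
def SetSuperior {V : Type} [Fintype V] (E : V → V → Prop) (Y : V) (S T : Set V) : Prop :=
  ∀ W ∈ T, ∃ X ∈ S, Superior E Y X W

/-- A globally interventionally superior set (GISS) of the graph relative to
`Y` : a subset `U` of `V \ {Y}` with `U ≽_Y (V \ {Y}) \ U`. -/
def IsGISS {V : Type} [Fintype V] (E : V → V → Prop) (Y : V) (U : Set V) : Prop :=
  U ⊆ Set.univ \ {Y} ∧ SetSuperior E Y U ((Set.univ \ {Y}) \ U)

/-- A minimal globally interventionally superior set (mGISS): a GISS that is
minimal with respect to set inclusion. -/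
def IsMGISS {V : Type} [Fintype V] (E : V → V → Prop) (Y : V) (U : Set V) : Prop :=
  IsGISS E Y U ∧ ∀ U' : Set V, IsGISS E Y U' → U' ⊆ U → U' = U

/-! ## Connectors -/

/-- `z` is a node of `C` at the end of a path from `v` uninterrupted by `C`. -/
def IsConnector {V : Type} (E : V → V → Prop) (C : Set V) (v z : V) : Prop :=
  z ∈ C ∧ ∃ p : List V, IsPath E v z p ∧ ∀ w ∈ p, w ∈ C → w = z

theorem isPath_singleton {V : Type} (E : V → V → Prop) (a : V) : IsPath E a a [a] :=
  ⟨List.isChain_singleton a, rfl, rfl⟩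

theorem IsPath.cons {V : Type} {E : V → V → Prop} {a b c : V} {p : List V}
    (hab : E a b) (hp : IsPath E b c p) : IsPath E a c (a :: p) := by
  obtain ⟨hc, hh, hl⟩ := hp
  cases p with
  | nil => simp at hh
  | cons d p =>
    obtain rfl : d = b := by simpa using hh
    exact ⟨List.isChain_cons_cons.2 ⟨hab, hc⟩, rfl, by rw [List.getLast?_cons_cons]; exact hl⟩

/-- A path is either trivial or an edge followed by a path. -/
theorem IsPath.eq_singleton_or_cons {V : Type} {E : V → V → Prop} {a b : V} {p : List V}
    (hp : IsPath E a b p) :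
    (a = b ∧ p = [a]) ∨ ∃ c q, E a c ∧ IsPath E c b q ∧ p = a :: q := by
  obtain ⟨hc, hh, hl⟩ := hp
  match p with
  | [] => simp at hh
  | [d] =>
    obtain rfl : d = a := by simpa using hh
    exact Or.inl ⟨by simpa using hl, rfl⟩
  | d :: e :: q =>
    obtain rfl : d = a := by simpa using hh
    have h := List.isChain_cons_cons.1 hc
    exact Or.inr ⟨e, e :: q, h.1, ⟨h.2, rfl, by rwa [List.getLast?_cons_cons] at hl⟩, rfl⟩

theorem IsPath.reflTransGen {V : Type} {E : V → V → Prop} {a b : V} {p : List V}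
    (hp : IsPath E a b p) : Relation.ReflTransGen E a b := by
  induction p generalizing a with
  | nil => simp [IsPath] at hp
  | cons d p ih =>
    rcases hp.eq_singleton_or_cons with ⟨rfl, -⟩ | ⟨c, q, hac, hq, h⟩
    · exact .refl
    · obtain ⟨-, rfl⟩ := List.cons.inj h
      exact .head hac (ih hq)

theorem exists_isPath_of_reflTransGen {V : Type} {E : V → V → Prop} {a b : V}
    (h : Relation.ReflTransGen E a b) : ∃ p, IsPath E a b p := by
  induction h using Relation.ReflTransGen.head_induction_on with
  | refl => exact ⟨[b], isPath_singleton E b⟩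
  | head hac _ ih =>
    obtain ⟨p, hp⟩ := ih
    exact ⟨_, hp.cons hac⟩

theorem isConnector_self {V : Type} (E : V → V → Prop) {C : Set V} {v : V} (hv : v ∈ C) :
    IsConnector E C v v :=
  ⟨hv, [v], isPath_singleton E v, by simp⟩

theorem IsConnector.head {V : Type} {E : V → V → Prop} {C : Set V} {v u z : V}
    (h : IsConnector E C u z) (hv : v ∉ C) (hvu : E v u) : IsConnector E C v z := by
  obtain ⟨hz, p, hp, hC⟩ := h
  refine ⟨hz, v :: p, hp.cons hvu, fun w hw hwC => ?_⟩
  rcases List.mem_cons.1 hw with rfl | hw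
  · exact absurd hwC hv
  · exact hC w hw hwC

/-- A path ending in `C` passes through a connector of its starting node. -/
theorem IsPath.exists_isConnector {V : Type} {E : V → V → Prop} {C : Set V} {a b : V}
    {p : List V} (hp : IsPath E a b p) (hb : b ∈ C) :
    ∃ z ∈ p, IsConnector E C a z ∧ Relation.ReflTransGen E z b := by
  induction p generalizing a with
  | nil => simp [IsPath] at hp
  | cons d p ih =>
    rcases hp.eq_singleton_or_cons with ⟨rfl, h⟩ | ⟨c, q, hac, hq, h⟩
    · exact ⟨a, by simp [h], isConnector_self E hb, .refl⟩
    · obtain ⟨rfl, rfl⟩ := List.cons.inj h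
      obtain ⟨z, hz, hcz, hzb⟩ := ih hq
      by_cases hd : d ∈ C
      · exact ⟨d, by simp, isConnector_self E hd, .head hac hq.reflTransGen⟩
      · exact ⟨z, List.mem_cons_of_mem _ hz, hcz.head hd hac, hzb⟩

/-- If `w` is a descendant of `v`, then either a connector of `v` lies above `w`, or every
connector of `w` is a connector of `v`. -/
theorem exists_isConnector_or_of_reflTransGen {V : Type} {E : V → V → Prop} {C : Set V}
    {v w : V} (h : Relation.ReflTransGen E v w) :
    (∃ z, IsConnector E C v z ∧ Relation.ReflTransGen E z w) ∨
      ∀ z, IsConnector E C w z → IsConnector E C v z := by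
  induction h using Relation.ReflTransGen.head_induction_on with
  | refl => exact Or.inr fun _ h => h
  | @head a c hac hcw ih =>
    by_cases ha : a ∈ C
    · exact Or.inl ⟨a, isConnector_self E ha, .head hac hcw⟩
    · rcases ih with ⟨z, hz, hzw⟩ | ih
      · exact Or.inl ⟨z, hz.head ha hac, hzw⟩
      · exact Or.inr fun z hz => (ih z hz).head ha hac

/-- In a set closed under lowest strict common ancestors, connectors of outside nodes are
unique. -/
theorem IsConnector.unique {V : Type} [Finite V] {E : V → V → Prop} (hacy : Acyclic E)
    {C : Set V} (hC : ∀ x ∈ C, ∀ y ∈ C, LSCApair E x y ⊆ C) {v x y : V} (hv : v ∉ C)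
    (hx : IsConnector E C v x) (hy : IsConnector E C v y) : x = y := by
  have : Std.Irrefl (Relation.TransGen E) := ⟨hacy⟩
  have wfUp : WellFounded (Relation.TransGen E) :=
    Finite.wellFounded_of_trans_of_irrefl _
  have wfDown : WellFounded (Function.swap (Relation.TransGen E)) :=
    Finite.wellFounded_of_trans_of_irrefl _
  induction v using wfDown.induction generalizing x y with
  | _ v ih =>
  by_contra hxy
  obtain ⟨m, hm, hmin⟩ := wfUp.has_min {z | IsConnector E C v z} ⟨x, hx⟩
  obtain ⟨n, hn, hmn⟩ : ∃ n, IsConnector E C v n ∧ m ≠ n := by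
    by_cases h : m = x
    · exact ⟨y, hy, h ▸ hxy⟩
    · exact ⟨x, hx, h⟩
  have hmin' : ∀ z, IsConnector E C v z → Relation.ReflTransGen E z m → z = m := by
    intro z hz hzm
    rcases Relation.reflTransGen_iff_eq_or_transGen.1 hzm with h | h
    · exact h.symm
    · exact absurd h (hmin z hz)
  refine hv (hC m hm.1 n hn.1 ⟨⟨?_, ?_⟩, ?_⟩)
  · obtain ⟨p, hp, hpC⟩ := hm.2
    exact ⟨p, hp, fun h => hmn (hpC n h hn.1).symm⟩
  · obtain ⟨p, hp, hpC⟩ := hn.2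
    exact ⟨p, hp, fun h => hmn (hpC m h hm.1)⟩
  · rintro w ⟨⟨p, hp, -⟩, q, hq, hmq⟩ hwv hvw
    have hwm : w ≠ m := by
      rintro rfl
      exact hmq (List.mem_of_head? hq.2.1)
    rcases exists_isConnector_or_of_reflTransGen (C := C) hvw with ⟨z, hz, hzw⟩ | hconn
    · obtain rfl := hmin' z hz (hzw.trans hp.reflTransGen)
      rcases Relation.reflTransGen_iff_eq_or_transGen.1 hzw with h | h
      · exact hwm h
      · exact hacy _ (h.trans_left hp.reflTransGen)
    · obtain ⟨z, -, hz, hzm⟩ := hp.exists_isConnector hm.1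
      obtain rfl := hmin' z (hconn z hz) hzm
      obtain ⟨z', hz'q, hz', -⟩ := hq.exists_isConnector hn.1
      have hlt : Relation.TransGen E v w :=
        (Relation.reflTransGen_iff_eq_or_transGen.1 hvw).resolve_left hwv
      have hwC : w ∉ C := fun h =>
        hwm (hmin' w (hconn w (isConnector_self E h)) hp.reflTransGen)
      exact hmq (ih w hlt hwC hz hz' ▸ hz'q)

theorem lscaIter_monotone {V : Type} (E : V → V → Prop) (U : Set V) :
    Monotone (lscaIter E U) :=
  monotone_nat_of_le_succ fun _ _ h => Or.inr h

/-- The LSCA closure is closed under lowest strict common ancestors. -/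
theorem LSCApair_subset_lscaClosure {V : Type} {E : V → V → Prop} {U : Set V} {x y : V}
    (hx : x ∈ lscaClosure E U) (hy : y ∈ lscaClosure E U) :
    LSCApair E x y ⊆ lscaClosure E U := by
  intro w hw
  obtain ⟨i, hi⟩ := Set.mem_iUnion.1 hx
  obtain ⟨j, hj⟩ := Set.mem_iUnion.1 hy
  by_contra hwC
  exact hwC (Set.mem_iUnion.2 ⟨max i j + 1, Or.inl ⟨fun h => hwC (Set.mem_iUnion.2 ⟨_, h⟩),
    x, lscaIter_monotone E U (le_max_left i j) hi,
    y, lscaIter_monotone E U (le_max_right i j) hj, hw⟩⟩)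

/-- Let `G = (V, E)` be a finite DAG, `U ⊆ V`, and `v ∈ V`
with `v ∉ L∞(U)` and `De(v) ∩ L∞(U) ≠ ∅`.  Then there is exactly one node
`v' ∈ L∞(U)` such that there exists a path from `v` to `v'` uninterrupted by
`L∞(U)` (its only node in `L∞(U)` is the endpoint `v'`). -/
theorem connector_unique {V : Type} [Fintype V] (E : V → V → Prop)
    (hacy : Acyclic E) (U : Set V) (v : V)
    (hv : v ∉ lscaClosure E U)
    (hne : (De E v ∩ lscaClosure E U).Nonempty) :
    ∃! v' : V, v' ∈ lscaClosure E U ∧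
      ∃ p : List V, IsPath E v v' p ∧ ∀ w ∈ p, w ∈ lscaClosure E U → w = v' := by
  obtain ⟨u, hvu, hu⟩ := hne
  obtain ⟨p, hp⟩ := exists_isPath_of_reflTransGen hvu
  obtain ⟨z, -, hz, -⟩ := hp.exists_isConnector hu
  exact ⟨z, hz, fun y hy => IsConnector.unique hacy
    (fun _ hx _ hy => LSCApair_subset_lscaClosure hx hy) hv hy hz⟩
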